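/- Let y_1 < y_2 < … < y_{T_0} be fixed real numbers and let X_{T_0+1},…,X_t be exchangeable real random variables that are almost surely pairwise distinct and almost surely distinct from every y_j. For T_0 < s ≤ t define the reduced rank R̃_s := 1 + #{j ≤ T_0 : y_j < X_s} and, for s = t, the sequential rank R_t := 1 + #{j ≤ T_0 : y_j < X_t} + #{s : T_0 < s < t, X_s < X_t}. Define q_t^i := (1 + #{s : T_0 < s ≤ t−1, R̃_s = i})/t for i = 1,…,T_0+1. Then, conditionally on the sequential ranks of X_{T_0+1},…,X_{t−1} (each among y_1,…,y_{T_0} and the earlier X's) and on the event {R̃_t = r}, the rank R_t is uniformly distributed on the set of integers { t·Σ_{i<r} q_t^i + 1, …, t·Σ_{i≤r} q_t^i }. -/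

import Mathlib

open MeasureTheory ProbabilityTheory
open scoped ENNReal NNReal

/-- A finite family of random elements is exchangeable if its joint law is invariant under
every permutation of the index set. -/
def Exchangeable {Ω ι α : Type*} [MeasurableSpace Ω] [MeasurableSpace α]
    (P : Measure Ω) (X : ι → Ω → α) : Prop :=
  ∀ π : Equiv.Perm ι,
    Measure.map (fun ω => fun i => X (π i) ω) P = Measure.map (fun ω => fun i => X i ω) P

/-- On a σ-algebra generated by a random element with countably many values, a conditional
expectation is determined by its averages over the fibres. -/
lemma condExp_comap_ae_eq_of_countable {Ω β : Type*} [mΩ : MeasurableSpace Ω]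
    [MeasurableSpace β] [Countable β] [MeasurableSingletonClass β]
    {P : Measure Ω} [IsFiniteMeasure P] {Z : Ω → β} (hZ : Measurable Z)
    {f g : Ω → ℝ} (hf : Integrable f P) {C : ℝ} (hgC : ∀ ω, |g ω| ≤ C)
    (hgZ : ∀ ω ω', Z ω = Z ω' → g ω = g ω')
    (hfg : ∀ ω₀, ∫ ω in Z ⁻¹' {Z ω₀}, f ω ∂P = g ω₀ * P.real (Z ⁻¹' {Z ω₀})) :
    P[f|MeasurableSpace.comap Z inferInstance] =ᵐ[P] g := by
  have hm : MeasurableSpace.comap Z inferInstance ≤ mΩ := hZ.comap_le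
  have hfac : g = Function.extend Z g 0 ∘ Z :=
    funext fun ω => (Function.FactorsThrough.extend_apply (fun a b h => hgZ a b h) 0 ω).symm
  have hgm : Measurable[MeasurableSpace.comap Z inferInstance] g := by
    rw [hfac]
    exact (measurable_of_countable _).comp (comap_measurable Z)
  have hgi : Integrable g P :=
    Integrable.of_bound (hgm.mono hm le_rfl).aestronglyMeasurable C
      (Filter.Eventually.of_forall hgC)
  refine (ae_eq_condExp_of_forall_setIntegral_eq hm hf (fun _ _ _ => hgi.integrableOn) ?_
    hgm.stronglyMeasurable.aestronglyMeasurable).symm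
  rintro _ ⟨A, -, rfl⟩ -
  have hA : Z ⁻¹' A = ⋃ a : A, Z ⁻¹' {(a : β)} := by
    ext ω; simp
  have hmeas : ∀ a : A, MeasurableSet (Z ⁻¹' {(a : β)}) :=
    fun a => hZ (measurableSet_singleton _)
  have hdisj : Pairwise (Function.onFun Disjoint fun a : A => Z ⁻¹' {(a : β)}) := by
    intro a b hab
    refine Disjoint.preimage Z ?_
    simpa using fun h => hab (Subtype.ext h)
  rw [hA, integral_iUnion hmeas hdisj hgi.integrableOn,
    integral_iUnion hmeas hdisj hf.integrableOn]
  refine tsum_congr fun a => ?_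
  by_cases ha : ∃ ω₀, Z ω₀ = a
  · obtain ⟨ω₀, h₀⟩ := ha
    rw [← h₀, hfg ω₀, setIntegral_congr_fun (g := fun _ => g ω₀) (hZ (measurableSet_singleton _))
      (fun ω hω => hgZ ω ω₀ hω)]
    simp [mul_comm]
  · have : Z ⁻¹' {(a : β)} = ∅ := by
      ext ω; simpa using fun h => ha ⟨ω, h⟩
    simp [this]

section Ranks

variable {κ ι : Type*} [LinearOrder ι]

/-- The entry at `k` comes right after the entry at `l`, with no reference value between. -/
def IsSuccEntry (y : κ → ℝ) (x : ι → ℝ) (k l : ι) : Prop :=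
  x l < x k ∧ (∀ j, y j < x k ↔ y j < x l) ∧ ∀ i, i ≠ k → i ≠ l → (x i < x k ↔ x i < x l)
    ∧ (x k < x i ↔ x l < x i)

lemma IsSuccEntry.swap {y : κ → ℝ} {x : ι → ℝ} {k l : ι} (h : IsSuccEntry y x k l) :
    IsSuccEntry y (x ∘ Equiv.swap k l) l k := by
  refine ⟨by simpa using h.1, fun j => by simpa using h.2.1 j, fun i hil hik => ?_⟩
  simpa [Equiv.swap_apply_of_ne_of_ne hik hil] using h.2.2 i hik hil

lemma IsSuccEntry.left_unique {y : κ → ℝ} {x : ι → ℝ} (hx : Function.Injective x) {k k' l : ι}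
    (h : IsSuccEntry y x k l) (h' : IsSuccEntry y x k' l) : k = k' := by
  by_contra hne
  have hkl : k ≠ l := by rintro rfl; exact h.1.false
  have hkl' : k' ≠ l := by rintro rfl; exact h'.1.false
  have h1 := (h.2.2 k' (Ne.symm hne) hkl').1
  have h2 := (h'.2.2 k hne hkl).1
  have h3 := hx.ne hne
  have h4 := h.1
  have h5 := h'.1
  grind

lemma IsSuccEntry.right_unique {y : κ → ℝ} {x : ι → ℝ} (hx : Function.Injective x) {k k' l : ι}
    (h : IsSuccEntry y x l k) (h' : IsSuccEntry y x l k') : k = k' := by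
  by_contra hne
  have hkl : k ≠ l := by rintro rfl; exact h.1.false
  have hkl' : k' ≠ l := by rintro rfl; exact h'.1.false
  have h1 := (h.2.2 k' hkl' (Ne.symm hne)).1
  have h2 := (h'.2.2 k hkl hne).1
  have h3 := hx.ne hne
  have h4 := h.1
  have h5 := h'.1
  grind

variable [Fintype κ] [Fintype ι]

/-- The rank of `v` among the reference values `y`. -/
noncomputable def reducedRank (y : κ → ℝ) (v : ℝ) : ℕ :=
  1 + (Finset.univ.filter fun j => y j < v).card

/-- The rank of `x k` among the reference values `y` and the earlier entries of `x`. -/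
noncomputable def sequentialRank (y : κ → ℝ) (x : ι → ℝ) (k : ι) : ℕ :=
  1 + (Finset.univ.filter fun j => y j < x k).card
    + (Finset.univ.filter fun i => i < k ∧ x i < x k).card

lemma reducedRank_mono (y : κ → ℝ) : Monotone (reducedRank y) := by
  intro u v huv
  unfold reducedRank
  gcongr

lemma lt_iff_lt_of_reducedRank_eq {y : κ → ℝ} {u v : ℝ}
    (h : reducedRank y u = reducedRank y v) (j : κ) : y j < u ↔ y j < v := by
  wlog huv : u ≤ v generalizing u v
  · exact (this h.symm (le_of_not_ge huv)).symm
  have hsub : (Finset.univ.filter fun j => y j < u) ⊆ Finset.univ.filter fun j => y j < v := by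
    gcongr
  have heq := Finset.eq_of_subset_of_card_le hsub (by unfold reducedRank at h; omega)
  simpa using Finset.ext_iff.1 heq j

lemma reducedRank_congr {y : κ → ℝ} {u v : ℝ} (h : ∀ j, y j < u ↔ y j < v) :
    reducedRank y u = reducedRank y v := by
  simp only [reducedRank, h]

lemma one_le_reducedRank (y : κ → ℝ) (v : ℝ) : 1 ≤ reducedRank y v :=
  Nat.le_add_right _ _

/-- Sequential ranks determine the relative order of all entries and reference values. -/
lemma order_eq_of_sequentialRank_eq {y : κ → ℝ} {x x' : ι → ℝ} (k : ι)
    (h : ∀ i ≤ k, sequentialRank y x i = sequentialRank y x' i) :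
    (∀ j, y j < x k ↔ y j < x' k) ∧ ∀ i < k, x i < x k ↔ x' i < x' k := by
  induction k using WellFoundedLT.induction with
  | ind k ih =>
    have ih' := fun i (hi : i < k) => ih i hi fun i' hi' => h i' (hi'.trans hi.le)
    let F : (ι → ℝ) → Finset (κ ⊕ ι) := fun z =>
      (Finset.univ.filter fun j => y j < z k).disjSum
        (Finset.univ.filter fun i => i < k ∧ z i < z k)
    have hcard : (F x).card = (F x').card := by
      have := h k le_rfl
      simp only [F, Finset.card_disjSum]
      unfold sequentialRank at this
      omega
    have hF : F x = F x' := by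
      have htot : F x ⊆ F x' ∨ F x' ⊆ F x := by
        by_contra! hcon
        obtain ⟨a, ha, ha'⟩ := Finset.not_subset.1 hcon.1
        obtain ⟨b, hb, hb'⟩ := Finset.not_subset.1 hcon.2
        rcases a with j | i <;> rcases b with j' | i' <;>
          simp [F] at ha ha' hb hb'
        · linarith
        · have h1 := ((ih' i' hb.1).1 j).1 (ha.trans_le (hb' hb.1))
          linarith
        · have h1 := ((ih' i ha.1).1 j').2 (hb.trans_le (ha' ha.1))
          linarith
        · have h1 : x i < x i' := ha.2.trans_le (hb' hb.1)
          have h2 : x' i' < x' i := hb.2.trans_le (ha' ha.1)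
          rcases lt_trichotomy i i' with hlt | rfl | hlt
          · exact h2.not_gt (((ih' i' hb.1).2 i hlt).1 h1)
          · exact h1.false
          · exact h1.not_gt (((ih' i ha.1).2 i' hlt).2 h2)
      rcases htot with hs | hs
      · exact Finset.eq_of_subset_of_card_le hs hcard.ge
      · exact (Finset.eq_of_subset_of_card_le hs hcard.le).symm
    refine ⟨fun j => by simpa [F] using Finset.ext_iff.1 hF (Sum.inl j), fun i hi => ?_⟩
    simpa [F, hi] using Finset.ext_iff.1 hF (Sum.inr i)

lemma reducedRank_eq_of_sequentialRank_eq {y : κ → ℝ} {x x' : ι → ℝ} {k : ι}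
    (h : ∀ i ≤ k, sequentialRank y x i = sequentialRank y x' i) :
    reducedRank y (x k) = reducedRank y (x' k) :=
  reducedRank_congr (order_eq_of_sequentialRank_eq k h).1

lemma measurable_sequentialRank (y : κ → ℝ) (k : ι) :
    Measurable fun x : ι → ℝ => sequentialRank y x k := by
  simp only [sequentialRank, Finset.card_filter]
  refine ((measurable_const).add (Finset.measurable_sum _ fun j _ => ?_)).add
    (Finset.measurable_sum _ fun i _ => ?_)
  · exact Measurable.ite (measurableSet_lt measurable_const (measurable_pi_apply k))
      measurable_const measurable_const
  · exact Measurable.ite ((MeasurableSet.const _).inter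
      (measurableSet_lt (measurable_pi_apply i) (measurable_pi_apply k)))
      measurable_const measurable_const

lemma measurable_reducedRank (y : κ → ℝ) : Measurable (reducedRank y) :=
  (reducedRank_mono y).measurable

/-- The vectors with the same earlier sequential ranks and the same reduced rank at `l` as `x₀`. -/
def rankFibre (y : κ → ℝ) (l : ι) (x₀ : ι → ℝ) : Set (ι → ℝ) :=
  {x | (∀ k < l, sequentialRank y x k = sequentialRank y x₀ k) ∧
    reducedRank y (x l) = reducedRank y (x₀ l)}

lemma measurableSet_rankFibre (y : κ → ℝ) (l : ι) (x₀ : ι → ℝ) :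
    MeasurableSet (rankFibre y l x₀) := by
  have : rankFibre y l x₀ = (⋂ k, ⋂ (_ : k < l),
      {x | sequentialRank y x k = sequentialRank y x₀ k}) ∩
      {x | reducedRank y (x l) = reducedRank y (x₀ l)} := by
    ext; simp [rankFibre]
  rw [this]
  refine (MeasurableSet.iInter fun k => MeasurableSet.iInter fun _ => ?_).inter ?_
  · exact measurable_sequentialRank y k (measurableSet_singleton _)
  · exact (measurable_reducedRank y).comp (measurable_pi_apply l) (measurableSet_singleton _)

/-- The number of earlier entries lying in a strictly lower slot than the entry at `l`. -/
noncomputable def lowerCount (y : κ → ℝ) (l : ι) (x : ι → ℝ) : ℕ :=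
  (Finset.univ.filter fun k => k < l ∧ reducedRank y (x k) < reducedRank y (x l)).card

/-- The number of earlier entries lying in the same slot as the entry at `l`. -/
noncomputable def slotCount (y : κ → ℝ) (l : ι) (x : ι → ℝ) : ℕ :=
  (Finset.univ.filter fun k => k < l ∧ reducedRank y (x k) = reducedRank y (x l)).card

/-- The number of earlier entries lying in the same slot as the entry at `l`, and below it. -/
noncomputable def slotBelowCount (y : κ → ℝ) (l : ι) (x : ι → ℝ) : ℕ :=
  (Finset.univ.filter fun k =>
    (k < l ∧ reducedRank y (x k) = reducedRank y (x l)) ∧ x k < x l).card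

lemma sequentialRank_eq_add (y : κ → ℝ) (l : ι) (x : ι → ℝ) :
    sequentialRank y x l
      = reducedRank y (x l) + lowerCount y l x + slotBelowCount y l x := by
  have : (Finset.univ.filter fun i => i < l ∧ x i < x l).card
      = lowerCount y l x + slotBelowCount y l x := by
    unfold lowerCount slotBelowCount
    rw [← Finset.card_union_of_disjoint]
    · congr 1
      ext k
      simp only [Finset.mem_filter, Finset.mem_univ, true_and, Finset.mem_union]
      constructor
      · rintro ⟨h1, h2⟩
        rcases (reducedRank_mono y h2.le).lt_or_eq with h | h
        · exact Or.inl ⟨h1, h⟩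
        · exact Or.inr ⟨⟨h1, h⟩, h2⟩
      · rintro (⟨h1, h⟩ | ⟨⟨h1, -⟩, h⟩)
        · exact ⟨h1, (reducedRank_mono y).reflect_lt h⟩
        · exact ⟨h1, h⟩
    · rw [Finset.disjoint_filter]
      rintro k - ⟨-, h⟩ ⟨⟨-, h'⟩, -⟩
      omega
  rw [sequentialRank, this, ← add_assoc]
  rfl

lemma slotBelowCount_le (y : κ → ℝ) (l : ι) (x : ι → ℝ) :
    slotBelowCount y l x ≤ slotCount y l x :=
  Finset.card_le_card fun k => by
    simp only [Finset.mem_filter, Finset.mem_univ, true_and]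
    exact And.left

lemma reducedRank_eq_of_mem_rankFibre {y : κ → ℝ} {l : ι} {x₀ x : ι → ℝ}
    (hx : x ∈ rankFibre y l x₀) {k : ι} (hk : k < l) :
    reducedRank y (x k) = reducedRank y (x₀ k) :=
  reducedRank_eq_of_sequentialRank_eq fun i hi => hx.1 i (hi.trans_lt hk)

lemma lowerCount_eq_of_mem_rankFibre {y : κ → ℝ} {l : ι} {x₀ x : ι → ℝ}
    (hx : x ∈ rankFibre y l x₀) : lowerCount y l x = lowerCount y l x₀ := by
  unfold lowerCount
  congr 1
  refine Finset.filter_congr fun k _ => and_congr_right fun hk => ?_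
  rw [reducedRank_eq_of_mem_rankFibre hx hk, hx.2]

lemma slotCount_eq_of_mem_rankFibre {y : κ → ℝ} {l : ι} {x₀ x : ι → ℝ}
    (hx : x ∈ rankFibre y l x₀) : slotCount y l x = slotCount y l x₀ := by
  unfold slotCount
  congr 1
  refine Finset.filter_congr fun k _ => and_congr_right fun hk => ?_
  rw [reducedRank_eq_of_mem_rankFibre hx hk, hx.2]

lemma measurableSet_isSuccEntry (y : κ → ℝ) (k l : ι) :
    MeasurableSet {x : ι → ℝ | IsSuccEntry y x k l} := by
  have hlt : ∀ a b : ι, Measurable fun x : ι → ℝ => x a < x b := fun a b =>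
    measurableSet_setOfPred.1 (measurableSet_lt (measurable_pi_apply a) (measurable_pi_apply b))
  have hy : ∀ j (a : ι), Measurable fun x : ι → ℝ => y j < x a := fun j a =>
    measurableSet_setOfPred.1 (measurableSet_lt measurable_const (measurable_pi_apply a))
  refine measurableSet_setOfPred.2 ((hlt l k).and
    ((Measurable.forall fun j => (hy j k).iff (hy j l)).and
      (Measurable.forall fun i => measurable_const.imp (measurable_const.imp ?_))))
  exact ((hlt i k).iff (hlt i l)).and ((hlt k i).iff (hlt l i))

section Last

variable {y : κ → ℝ} {l : ι} {x x₀ : ι → ℝ}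

lemma IsSuccEntry.sequentialRank_swap_of_lt {k : ι} (h : IsSuccEntry y x k l)
    {a : ι} (ha : a < l) :
    sequentialRank y (x ∘ Equiv.swap k l) a = sequentialRank y x a := by
  obtain ⟨h1, h2, h3⟩ := h
  have hy : ∀ j, y j < (x ∘ Equiv.swap k l) a ↔ y j < x a := by
    intro j
    by_cases hak : a = k
    · subst hak; simpa using (h2 j).symm
    · simp [Equiv.swap_apply_of_ne_of_ne hak ha.ne]
  have hx : ∀ i, (i < a ∧ (x ∘ Equiv.swap k l) i < (x ∘ Equiv.swap k l) a) ↔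
      (i < a ∧ x i < x a) := by
    refine fun i => and_congr_right fun hi => ?_
    have hil : i ≠ l := (hi.trans ha).ne
    by_cases hak : a = k
    · subst hak
      simpa [Equiv.swap_apply_of_ne_of_ne hi.ne hil] using (h3 i hi.ne hil).1.symm
    · by_cases hik : i = k
      · subst hik
        simpa [Equiv.swap_apply_of_ne_of_ne hak ha.ne] using (h3 a hak ha.ne).2.symm
      · simp [Equiv.swap_apply_of_ne_of_ne hak ha.ne, Equiv.swap_apply_of_ne_of_ne hik hil]
  simp only [sequentialRank, hy, hx]

lemma IsSuccEntry.sequentialRank_swap_last {k : ι} (h : IsSuccEntry y x k l) (hl : ∀ i, i ≤ l) :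
    sequentialRank y (x ∘ Equiv.swap k l) l = sequentialRank y x l + 1 := by
  obtain ⟨h1, h2, h3⟩ := h
  have hkl : k ≠ l := by rintro rfl; exact h1.false
  have hins : (Finset.univ.filter fun i =>
        i < l ∧ (x ∘ Equiv.swap k l) i < (x ∘ Equiv.swap k l) l)
      = insert k (Finset.univ.filter fun i => i < l ∧ x i < x l) := by
    ext i
    by_cases hik : i = k
    · subst hik; simp [h1, lt_of_le_of_ne (hl i) hkl]
    · by_cases hil : i = l
      · subst hil; simp [hik]
      · simp [hik, Equiv.swap_apply_of_ne_of_ne hik hil, (h3 i hik hil).1]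
  rw [sequentialRank, hins, Finset.card_insert_of_notMem (by simp [h1.not_gt])]
  simp [sequentialRank, h2, add_assoc]

lemma IsSuccEntry.swap_mem_rankFibre_iff {k : ι} (h : IsSuccEntry y x k l) :
    x ∘ Equiv.swap k l ∈ rankFibre y l x₀ ↔ x ∈ rankFibre y l x₀ := by
  have hr : reducedRank y ((x ∘ Equiv.swap k l) l) = reducedRank y (x l) :=
    reducedRank_congr fun j => by simpa using h.2.1 j
  unfold rankFibre
  simp only [Set.mem_ofPred_eq, hr]
  refine and_congr_left fun _ => forall₂_congr fun a ha => ?_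
  rw [h.sequentialRank_swap_of_lt ha]

lemma exists_isSuccEntry_of_lt (hx : Function.Injective x) (hl : ∀ i, i ≤ l)
    (h : slotBelowCount y l x < slotCount y l x) : ∃ k, IsSuccEntry y x k l := by
  let S := Finset.univ.filter fun k =>
    (k < l ∧ reducedRank y (x k) = reducedRank y (x l)) ∧ x l < x k
  have hS : S.Nonempty := by
    obtain ⟨k, hk, hk'⟩ := Finset.exists_mem_notMem_of_card_lt_card h
    simp only [Finset.mem_filter, Finset.mem_univ, true_and, not_and, not_lt] at hk hk'
    refine ⟨k, ?_⟩
    simp only [S, Finset.mem_filter, Finset.mem_univ, true_and]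
    exact ⟨hk, lt_of_le_of_ne (hk' hk) fun e => hk.1.ne' (hx e)⟩
  obtain ⟨k, hkS, hmin⟩ := S.exists_min_image x hS
  simp only [S, Finset.mem_filter, Finset.mem_univ, true_and] at hkS hmin
  refine ⟨k, hkS.2, lt_iff_lt_of_reducedRank_eq hkS.1.2, fun i hik hil => ?_⟩
  have hgap : x i ≤ x l ∨ x k ≤ x i := by
    by_contra! hcon
    refine hcon.2.not_ge (hmin i ⟨⟨lt_of_le_of_ne (hl i) hil, le_antisymm ?_ ?_⟩, hcon.1⟩)
    · exact (reducedRank_mono y hcon.2.le).trans hkS.1.2.le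
    · exact reducedRank_mono y hcon.1.le
  have h1 := hx.ne hik
  have h2 := hx.ne hil
  have h3 := hkS.2
  grind

lemma exists_isSuccEntry_of_pos (hx : Function.Injective x) (hl : ∀ i, i ≤ l)
    (h : 0 < slotBelowCount y l x) : ∃ k, IsSuccEntry y x l k := by
  let S := Finset.univ.filter fun k =>
    (k < l ∧ reducedRank y (x k) = reducedRank y (x l)) ∧ x k < x l
  obtain ⟨k, hkS, hmax⟩ := S.exists_max_image x (Finset.card_pos.1 h)
  simp only [S, Finset.mem_filter, Finset.mem_univ, true_and] at hkS hmax
  refine ⟨k, hkS.2, lt_iff_lt_of_reducedRank_eq hkS.1.2.symm, fun i hil hik => ?_⟩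
  have hgap : x i ≤ x k ∨ x l ≤ x i := by
    by_contra! hcon
    refine hcon.1.not_ge (hmax i ⟨⟨lt_of_le_of_ne (hl i) hil, le_antisymm ?_ ?_⟩, hcon.2⟩)
    · exact reducedRank_mono y hcon.2.le
    · exact hkS.1.2.ge.trans (reducedRank_mono y hcon.1.le)
  have h1 := hx.ne hik
  have h2 := hx.ne hil
  have h3 := hkS.2
  grind

end Last

lemma measurableSet_rankFibre_inter (y : κ → ℝ) (l : ι) (x₀ : ι → ℝ) (n : ℕ) :
    MeasurableSet (rankFibre y l x₀ ∩ {x | sequentialRank y x l = n}) :=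
  (measurableSet_rankFibre y l x₀).inter
    (measurable_sequentialRank y l (measurableSet_singleton n))

section Measure

variable {μ : Measure (ι → ℝ)} {y : κ → ℝ} {l : ι} {x₀ : ι → ℝ}

lemma measure_rankFibre_succ (hμ : ∀ π : Equiv.Perm ι, μ.map (fun x => x ∘ π) = μ)
    (hinj : ∀ᵐ x ∂μ, Function.Injective x) (hl : ∀ i, i ≤ l) {j : ℕ}
    (hj : j < slotCount y l x₀) :
    μ (rankFibre y l x₀ ∩
        {x | sequentialRank y x l = reducedRank y (x₀ l) + lowerCount y l x₀ + j}) =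
      μ (rankFibre y l x₀ ∩
        {x | sequentialRank y x l = reducedRank y (x₀ l) + lowerCount y l x₀ + (j + 1)}) := by
  set B : ℕ → Set (ι → ℝ) := fun j => rankFibre y l x₀ ∩
    {x | sequentialRank y x l = reducedRank y (x₀ l) + lowerCount y l x₀ + j} with hB
  have hBm : ∀ j, MeasurableSet (B j) := fun j => measurableSet_rankFibre_inter y l x₀ _
  have hcount : ∀ j, ∀ x ∈ B j, slotBelowCount y l x = j := by
    rintro j x ⟨hx, hx'⟩
    have := sequentialRank_eq_add y l x
    rw [hx', lowerCount_eq_of_mem_rankFibre hx, hx.2] at this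
    omega
  let U : ι → Set (ι → ℝ) := fun k => B j ∩ {x | IsSuccEntry y x k l}
  let V : ι → Set (ι → ℝ) := fun k => B (j + 1) ∩ {x | IsSuccEntry y x l k}
  have hU : B j =ᵐ[μ] ⋃ k, U k := by
    filter_upwards [hinj] with x hx
    refine propext ⟨fun hxB => ?_, fun h => ?_⟩
    · obtain ⟨k, hk⟩ := exists_isSuccEntry_of_lt (y := y) (l := l) hx hl (by
        rw [hcount j x hxB, slotCount_eq_of_mem_rankFibre hxB.1]; exact hj)
      exact Set.mem_iUnion.2 ⟨k, hxB, hk⟩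
    · obtain ⟨k, hk⟩ := Set.mem_iUnion.1 h
      exact hk.1
  have hV : B (j + 1) =ᵐ[μ] ⋃ k, V k := by
    filter_upwards [hinj] with x hx
    refine propext ⟨fun hxB => ?_, fun h => ?_⟩
    · obtain ⟨k, hk⟩ := exists_isSuccEntry_of_pos (y := y) (l := l) hx hl (by
        rw [hcount _ x hxB]; exact j.succ_pos)
      exact Set.mem_iUnion.2 ⟨k, hxB, hk⟩
    · obtain ⟨k, hk⟩ := Set.mem_iUnion.1 h
      exact hk.1
  have hUm : ∀ k, MeasurableSet (U k) := fun k =>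
    (hBm j).inter (measurableSet_isSuccEntry y k l)
  have hVm : ∀ k, MeasurableSet (V k) := fun k =>
    (hBm (j + 1)).inter (measurableSet_isSuccEntry y l k)
  have hUd : Pairwise (Function.onFun (AEDisjoint μ) U) := by
    intro k k' hne
    refine measure_mono_null ?_ (ae_iff.1 hinj)
    exact fun x hx hx' => hne (hx.1.2.left_unique hx' hx.2.2)
  have hVd : Pairwise (Function.onFun (AEDisjoint μ) V) := by
    intro k k' hne
    refine measure_mono_null ?_ (ae_iff.1 hinj)
    exact fun x hx hx' => hne (hx.1.2.right_unique hx' hx.2.2)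
  rw [measure_congr hU, measure_congr hV,
    measure_iUnion₀ hUd fun k => (hUm k).nullMeasurableSet,
    measure_iUnion₀ hVd fun k => (hVm k).nullMeasurableSet]
  refine tsum_congr fun k => ?_
  have hpre : (fun x : ι → ℝ => x ∘ Equiv.swap k l) ⁻¹' V k = U k := by
    have hfwd : ∀ x, IsSuccEntry y x k l → (x ∘ Equiv.swap k l ∈ B (j + 1) ↔ x ∈ B j) := by
      intro x h
      simp only [hB, Set.mem_inter_iff, h.swap_mem_rankFibre_iff, Set.mem_ofPred_eq,
        h.sequentialRank_swap_last hl]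
      refine and_congr_right fun _ => ?_
      omega
    ext x
    constructor
    · rintro ⟨hx, hs⟩
      have hs' := IsSuccEntry.swap hs
      have hxx : (x ∘ Equiv.swap k l) ∘ Equiv.swap l k = x := by
        ext i; simp [Equiv.swap_comm l k]
      rw [hxx] at hs'
      exact ⟨(hfwd x hs').1 hx, hs'⟩
    · rintro ⟨hx, hs⟩
      exact ⟨(hfwd x hs).2 hx, hs.swap⟩
  have hmeas : Measurable fun x : ι → ℝ => x ∘ Equiv.swap k l :=
    measurable_pi_lambda _ fun i => measurable_pi_apply _
  rw [← hpre, ← Measure.map_apply hmeas (hVm k), hμ]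

/-- Within a fibre the last sequential rank is uniform on the positions of its slot. -/
lemma measureReal_rankFibre_inter [IsFiniteMeasure μ]
    (hμ : ∀ π : Equiv.Perm ι, μ.map (fun x => x ∘ π) = μ)
    (hinj : ∀ᵐ x ∂μ, Function.Injective x) (hl : ∀ i, i ≤ l) (n : ℕ) :
    μ.real (rankFibre y l x₀ ∩ {x | sequentialRank y x l = n}) =
      (if reducedRank y (x₀ l) + lowerCount y l x₀ ≤ n ∧
          n ≤ reducedRank y (x₀ l) + lowerCount y l x₀ + slotCount y l x₀
        then ((1 : ℝ) + slotCount y l x₀)⁻¹ else 0) * μ.real (rankFibre y l x₀) := by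
  set L := reducedRank y (x₀ l) + lowerCount y l x₀ with hL
  set c := slotCount y l x₀ with hc
  set B : ℕ → Set (ι → ℝ) := fun j => rankFibre y l x₀ ∩ {x | sequentialRank y x l = L + j}
    with hB
  have hrange : ∀ x ∈ rankFibre y l x₀,
      ∃ j ∈ Finset.range (c + 1), sequentialRank y x l = L + j := by
    intro x hx
    refine ⟨slotBelowCount y l x, ?_, ?_⟩
    · have := slotBelowCount_le y l x
      rw [slotCount_eq_of_mem_rankFibre hx] at this
      exact Finset.mem_range.2 (Nat.lt_succ_of_le this)
    · rw [sequentialRank_eq_add, hx.2, lowerCount_eq_of_mem_rankFibre hx]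
  have hconst : ∀ j ≤ c, μ.real (B j) = μ.real (B 0) := by
    intro j
    induction j with
    | zero => simp
    | succ j ih =>
      intro hj
      rw [← ih (by omega), Measure.real, Measure.real, measure_rankFibre_succ hμ hinj hl hj]
  have hsum : μ.real (rankFibre y l x₀) = (1 + c) * μ.real (B 0) := by
    have hU : rankFibre y l x₀ = ⋃ j ∈ Finset.range (c + 1), B j := by
      ext x
      simp only [Set.mem_iUnion]
      refine ⟨fun hx => ?_, fun ⟨j, _, h⟩ => h.1⟩
      obtain ⟨j, hj, h⟩ := hrange x hx
      exact ⟨j, hj, hx, h⟩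
    rw [hU, measureReal_biUnion_finset]
    · rw [Finset.sum_congr rfl fun j hj => hconst j (by simpa [Nat.lt_succ_iff] using hj)]
      simp [add_comm]
    · intro i _ j _ hij
      refine Set.disjoint_left.2 fun x hx hx' => hij ?_
      have h1 : sequentialRank y x l = L + i := hx.2
      have h2 : sequentialRank y x l = L + j := hx'.2
      omega
    · exact fun j _ => measurableSet_rankFibre_inter y l x₀ _
  split_ifs with h
  · obtain ⟨j, rfl⟩ := Nat.exists_eq_add_of_le h.1
    have := hconst j (by omega)
    rw [hsum, ← mul_assoc, inv_mul_cancel₀ (by positivity), one_mul, ← this]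
  · have : rankFibre y l x₀ ∩ {x | sequentialRank y x l = n} = ∅ := by
      refine Set.eq_empty_of_forall_notMem fun x hx => h ?_
      obtain ⟨j, hj, hx'⟩ := hrange x hx.1
      have h2 : sequentialRank y x l = n := hx.2
      rw [Finset.mem_range] at hj
      omega
    simp [this]

end Measure

end Ranks

/-- Fixed pre-treatment values `y_1 < … < y_{T0}` and exchangeable
post-treatment observations `X_{T0+1},…,X_t` (here indexed 0-based by `Fin (t−T0)`, the
current one being the last index), a.s. pairwise distinct and distinct from the `y_j`.
With reduced ranks `R̃`, sequential ranks `R`, and `q_t^i` as in the paper, conditionally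
on the sequential ranks of the earlier post-treatment observations and on the reduced rank
of the current one, the current sequential rank `R_t` is uniform on the set of integers
`{t·Σ_{i<r} q_t^i + 1, …, t·Σ_{i≤r} q_t^i}` where `r` is the current reduced rank. -/
theorem stmt_16
    {Ω : Type*} [mΩ : MeasurableSpace Ω] (P : Measure Ω) [IsProbabilityMeasure P]
    (t T0 : ℕ) (hT0 : 1 ≤ T0) (hT0t : T0 < t)
    (y : Fin T0 → ℝ) (hy : StrictMono y)
    (X : Fin (t - T0) → Ω → ℝ) (hX : ∀ k, Measurable (X k))
    (hexch : Exchangeable P X)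
    (hdist : ∀ᵐ ω ∂P, (∀ k k' : Fin (t - T0), k ≠ k' → X k ω ≠ X k' ω)
      ∧ ∀ (k : Fin (t - T0)) (j : Fin T0), X k ω ≠ y j)
    (Rred : Fin (t - T0) → Ω → ℕ)
    (hRred : ∀ k ω, Rred k ω
      = 1 + (Finset.univ.filter (fun j : Fin T0 => y j < X k ω)).card)
    (Rseq : Fin (t - T0) → Ω → ℕ)
    (hRseq : ∀ k ω, Rseq k ω
      = 1 + (Finset.univ.filter (fun j : Fin T0 => y j < X k ω)).card
        + (Finset.univ.filter (fun k' : Fin (t - T0) => k' < k ∧ X k' ω < X k ω)).card)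
    (klast : Fin (t - T0)) (hklast : (klast : ℕ) = t - T0 - 1)
    (q : ℕ → Ω → ℝ)
    (hq : ∀ i ω, q i ω
      = (1 + ((Finset.univ.filter
          (fun k : Fin (t - T0) => (k : ℕ) + 1 < t - T0 ∧ Rred k ω = i)).card : ℝ)) / (t : ℝ))
    (𝒢 : MeasurableSpace Ω)
    (h𝒢 : 𝒢 = MeasurableSpace.comap
      (fun ω => ((fun k : {k : Fin (t - T0) // (k : ℕ) + 1 < t - T0} => Rseq k.1 ω),
        Rred klast ω))
      inferInstance) :
    ∀ n : ℕ,
      P[Set.indicator {ω | Rseq klast ω = n} (fun _ => (1 : ℝ))|𝒢]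
        =ᵐ[P] fun ω =>
          if (t : ℝ) * (∑ i ∈ Finset.Icc 1 (Rred klast ω - 1), q i ω) < (n : ℝ)
              ∧ (n : ℝ) ≤ (t : ℝ) * (∑ i ∈ Finset.Icc 1 (Rred klast ω), q i ω)
          then ((t : ℝ) * q (Rred klast ω) ω)⁻¹ else 0 := by
  intro n
  subst h𝒢
  have hl : ∀ i, i ≤ klast := fun i => Fin.le_def.2 (by omega)
  have hlt : ∀ i : Fin (t - T0), (i : ℕ) + 1 < t - T0 ↔ i < klast := fun i => by
    rw [Fin.lt_def]; omega
  have hred : ∀ k ω, Rred k ω = reducedRank y (X k ω) := hRred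
  have hseq : ∀ k ω, Rseq k ω = sequentialRank y (fun i => X i ω) k := hRseq
  have hXm : Measurable fun ω i => X i ω := measurable_pi_lambda _ hX
  have hRseqm : ∀ k, Measurable (Rseq k) := fun k => by
    rw [show Rseq k = (fun x => sequentialRank y x k) ∘ fun ω i => X i ω from funext (hseq k)]
    exact (measurable_sequentialRank y k).comp hXm
  have hRredm : ∀ k, Measurable (Rred k) := fun k => by
    rw [show Rred k = reducedRank y ∘ X k from funext (hred k)]
    exact (measurable_reducedRank y).comp (hX k)
  have ht : (t : ℝ) ≠ 0 := by exact_mod_cast (by omega : t ≠ 0)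
  have htq : ∀ i ω, (t : ℝ) * q i ω
      = 1 + ((Finset.univ.filter fun k => k < klast ∧ Rred k ω = i).card : ℝ) := by
    intro i ω
    simp only [hq, hlt]
    field_simp
  have hslot : ∀ ω, (t : ℝ) * q (Rred klast ω) ω
      = 1 + slotCount y klast (fun i => X i ω) := by
    intro ω
    simp only [htq, hred, slotCount]
  have hlower : ∀ ω, (t : ℝ) * (∑ i ∈ Finset.Icc 1 (Rred klast ω - 1), q i ω)
      = (Rred klast ω : ℝ) - 1 + lowerCount y klast (fun i => X i ω) := by
    intro ω
    have h1 : 1 ≤ Rred klast ω := by rw [hred]; exact one_le_reducedRank _ _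
    have hc : lowerCount y klast (fun i => X i ω) = ∑ i ∈ Finset.Icc 1 (Rred klast ω - 1),
        (Finset.univ.filter fun k => k < klast ∧ Rred k ω = i).card := by
      rw [lowerCount, Finset.card_eq_sum_card_fiberwise (f := fun k => Rred k ω)
        (t := Finset.Icc 1 (Rred klast ω - 1))]
      · refine Finset.sum_congr rfl fun i hi => ?_
        rw [Finset.filter_filter]
        congr 1
        refine Finset.filter_congr fun k _ => ?_
        rw [Finset.mem_Icc] at hi
        rw [← hred, ← hred]
        constructor
        · rintro ⟨⟨h, -⟩, h'⟩; exact ⟨h, h'⟩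
        · rintro ⟨h, h'⟩; exact ⟨⟨h, by omega⟩, h'⟩
      · intro k hk
        have hk' := (Finset.mem_filter.1 hk).2.2
        have h2 : 1 ≤ Rred k ω := by rw [hred]; exact one_le_reducedRank _ _
        rw [← hred, ← hred] at hk'
        exact Finset.mem_coe.2 (Finset.mem_Icc.2 ⟨h2, by dsimp only; omega⟩)
    rw [Finset.mul_sum, Finset.sum_congr rfl fun i _ => htq i ω, Finset.sum_add_distrib, hc]
    push_cast [h1]
    simp [h1]
  have hupper : ∀ ω, (t : ℝ) * (∑ i ∈ Finset.Icc 1 (Rred klast ω), q i ω)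
      = (Rred klast ω : ℝ) + lowerCount y klast (fun i => X i ω)
        + slotCount y klast (fun i => X i ω) := by
    intro ω
    have h1 : 1 ≤ Rred klast ω := by rw [hred]; exact one_le_reducedRank _ _
    obtain ⟨r, hr⟩ := Nat.exists_eq_add_of_le' h1
    have hlo := hlower ω
    have hsl := hslot ω
    rw [hr] at hlo hsl ⊢
    rw [Finset.sum_Icc_succ_top (by omega), mul_add, hsl]
    rw [Nat.add_sub_cancel] at hlo
    rw [hlo]
    push_cast
    ring
  have hg : (fun ω => if (t : ℝ) * (∑ i ∈ Finset.Icc 1 (Rred klast ω - 1), q i ω) < (n : ℝ)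
        ∧ (n : ℝ) ≤ (t : ℝ) * (∑ i ∈ Finset.Icc 1 (Rred klast ω), q i ω)
        then ((t : ℝ) * q (Rred klast ω) ω)⁻¹ else 0)
      = fun ω => if reducedRank y (X klast ω) + lowerCount y klast (fun i => X i ω) ≤ n ∧
          n ≤ reducedRank y (X klast ω) + lowerCount y klast (fun i => X i ω)
            + slotCount y klast (fun i => X i ω)
        then ((1 : ℝ) + slotCount y klast (fun i => X i ω))⁻¹ else 0 := by
    funext ω
    rw [hlower, hupper, hslot, hred]
    refine if_congr (and_congr ?_ ?_) rfl rfl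
    · rw [← Nat.lt_succ_iff, ← Nat.cast_lt (α := ℝ)]
      push_cast
      constructor <;> intro h <;> linarith
    · exact_mod_cast Iff.rfl
  rw [hg]
  have hfibre : ∀ ω₀, (fun ω => ((fun k : {k : Fin (t - T0) // (k : ℕ) + 1 < t - T0} =>
        Rseq k.1 ω), Rred klast ω)) ⁻¹' {((fun k => Rseq k.1 ω₀), Rred klast ω₀)}
      = (fun ω i => X i ω) ⁻¹' rankFibre y klast (fun i => X i ω₀) := by
    intro ω₀
    ext ω
    simp only [Set.mem_preimage, Set.mem_singleton_iff, Prod.mk.injEq, funext_iff, Subtype.forall,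
      hlt, hseq, hred, rankFibre, Set.mem_ofPred_eq]
  have hE : MeasurableSet {ω | Rseq klast ω = n} := hRseqm klast (measurableSet_singleton n)
  have hZ : Measurable fun ω =>
      ((fun k : {k : Fin (t - T0) // (k : ℕ) + 1 < t - T0} => Rseq k.1 ω), Rred klast ω) :=
    Measurable.prodMk (measurable_pi_lambda _ fun k => hRseqm k.1) (hRredm klast)
  refine condExp_comap_ae_eq_of_countable (P := P) (C := 1)
    hZ ((integrable_const _).indicator hE) ?_ ?_ ?_
  · intro ω
    split_ifs
    · rw [abs_of_nonneg (by positivity)]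
      exact inv_le_one_of_one_le₀ (by simp)
    · simp
  · intro ω ω₀ h
    have hmem : (fun i => X i ω) ∈ rankFibre y klast (fun i => X i ω₀) := by
      change ω ∈ (fun ω i => X i ω) ⁻¹' rankFibre y klast (fun i => X i ω₀)
      rw [← hfibre ω₀]
      exact h
    rw [lowerCount_eq_of_mem_rankFibre hmem, slotCount_eq_of_mem_rankFibre hmem, hmem.2]
  · intro ω₀
    have hμ : ∀ π : Equiv.Perm (Fin (t - T0)),
        (P.map fun ω i => X i ω).map (fun x => x ∘ π) = P.map fun ω i => X i ω := by
      intro π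
      have hπ : Measurable fun x : Fin (t - T0) → ℝ => x ∘ π :=
        measurable_pi_lambda _ fun i => measurable_pi_apply _
      rw [Measure.map_map hπ hXm]
      exact hexch π
    have hinj : ∀ᵐ x ∂(P.map fun ω i => X i ω), Function.Injective x := by
      have hm : MeasurableSet {x : Fin (t - T0) → ℝ | Function.Injective x} := by
        refine measurableSet_setOfPred.2 (Measurable.forall fun a => Measurable.forall fun b =>
          Measurable.imp (measurableSet_setOfPred.1 ?_) measurable_const)
        exact measurableSet_eq_fun (measurable_pi_apply a) (measurable_pi_apply b)
      rw [ae_map_iff hXm.aemeasurable hm]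
      filter_upwards [hdist] with ω hω a b hab
      by_contra hne
      exact hω.1 a b hne hab
    have : IsProbabilityMeasure (P.map fun ω i => X i ω) :=
      Measure.isProbabilityMeasure_map hXm.aemeasurable
    have key := measureReal_rankFibre_inter (y := y) (x₀ := fun i => X i ω₀) hμ hinj hl n
    rw [map_measureReal_apply hXm (measurableSet_rankFibre_inter y klast _ n),
      map_measureReal_apply hXm (measurableSet_rankFibre y klast _)] at key
    rw [hfibre ω₀, ← key, setIntegral_indicator hE, setIntegral_const, smul_eq_mul, mul_one]
    congr 1
    ext ω
    simp [hseq]
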